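/- For all nonnegative integers m and n, the function 𝔜_{m,n}(t) = t^{m+n+1} h(t) / ∫_0^t u^m (t−u)^n h(u) h(t−u) du is strictly decreasing in t on (0,∞). -/

import Mathlib

open MeasureTheory

noncomputable def h (t : ℝ) : ℝ :=
  if t = 0 then 1 / 2 else Real.exp t * (Real.exp t - 1 - t) / (Real.exp t - 1) ^ 2

noncomputable def frakY (m n : ℕ) (t : ℝ) : ℝ :=
  t ^ (m + n + 1) * h t / ∫ u in (0:ℝ)..t, u ^ m * (t - u) ^ n * h u * h (t - u)

lemma pos_of_hasDerivAt_pos {f f' : ℝ → ℝ} (hf : ∀ t, HasDerivAt f (f' t) t) (h0 : f 0 = 0)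
    (hf' : ∀ t, 0 < t → 0 < f' t) {t : ℝ} (ht : 0 < t) : 0 < f t := by
  have hmono : StrictMonoOn f (Set.Ici 0) := by
    apply strictMonoOn_of_deriv_pos (convex_Ici 0)
    · exact fun x _ => (hf x).continuousAt.continuousWithinAt
    · intro x hx
      rw [interior_Ici] at hx
      rw [(hf x).deriv]
      exact hf' x hx
  simpa [h0] using hmono Set.self_mem_Ici ht.le ht

lemma hasDerivAt_expPoly (a b c d e f g p q r t : ℝ) :
    HasDerivAt (fun t => (a * t + b) * Real.exp t ^ 3 + (c * t + d) * Real.exp t ^ 2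
        + (e * t ^ 2 + f * t + g) * Real.exp t + (p * t ^ 2 + q * t + r))
      ((3 * a * t + 3 * b + a) * Real.exp t ^ 3 + (2 * c * t + 2 * d + c) * Real.exp t ^ 2
        + (e * t ^ 2 + (f + 2 * e) * t + (g + f)) * Real.exp t + (2 * p * t + q)) t := by
  have hE := Real.hasDerivAt_exp t
  have hid := hasDerivAt_id' t
  have hquad : ∀ e f g : ℝ, HasDerivAt (fun t => e * t ^ 2 + f * t + g) (2 * e * t + f) t :=
    fun e f g => ((((hid.fun_pow 2).const_mul e).fun_add (hid.const_mul f)).add_const g).congr_deriv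
      (by push_cast; ring)
  refine ((((((hid.const_mul a).add_const b).fun_mul (hE.fun_pow 3)).fun_add
    (((hid.const_mul c).add_const d).fun_mul (hE.fun_pow 2))).fun_add
    ((hquad e f g).fun_mul hE)).fun_add (hquad p q r)).congr_deriv ?_
  push_cast
  ring

lemma expPoly_pos {t : ℝ} (ht : 0 < t) :
    0 < (t - 3) * Real.exp t ^ 3 + (2 * t + 7) * Real.exp t ^ 2
      + (-2 * t ^ 2 - 3 * t - 5) * Real.exp t + 1 := by
  have h5 : ∀ t : ℝ, 0 < t → 0 < (6 * t - 1) * Real.exp t + 1 := fun t ht =>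
    pos_of_hasDerivAt_pos (f := fun t => (6 * t - 1) * Real.exp t + 1)
      (f' := fun t => (6 * t + 5) * Real.exp t)
      (fun t => by
        convert hasDerivAt_expPoly 0 0 0 0 0 6 (-1) 0 0 1 t using 1
        · ext x; ring
        · ring)
      (by simp) (fun t ht => by positivity) ht
  have h4 : ∀ t : ℝ, 0 < t → 0 < (6 * t - 7) * Real.exp t + (t + 7) := fun t ht =>
    pos_of_hasDerivAt_pos (f := fun t => (6 * t - 7) * Real.exp t + (t + 7))
      (fun t => by
        convert hasDerivAt_expPoly 0 0 0 0 0 6 (-7) 0 1 7 t using 1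
        · ext x; ring
        · ring)
      (by simp) h5 ht
  have h3 : ∀ t : ℝ, 0 < t →
      0 < (12 * t - 20) * Real.exp t ^ 2 + (4 * t + 24) * Real.exp t - 4 := fun t ht =>
    pos_of_hasDerivAt_pos
      (f := fun t => (12 * t - 20) * Real.exp t ^ 2 + (4 * t + 24) * Real.exp t - 4)
      (f' := fun t => 4 * Real.exp t * ((6 * t - 7) * Real.exp t + (t + 7)))
      (fun t => by
        convert hasDerivAt_expPoly 0 0 12 (-20) 0 4 24 0 0 (-4) t using 1
        · ext x; ring
        · ring)
      (by norm_num) (fun t ht => mul_pos (by positivity) (h4 t ht)) ht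
  have h2 : ∀ t : ℝ, 0 < t →
      0 < (6 * t - 13) * Real.exp t ^ 2 + (4 * t + 20) * Real.exp t - (4 * t + 7) := fun t ht =>
    pos_of_hasDerivAt_pos
      (f := fun t => (6 * t - 13) * Real.exp t ^ 2 + (4 * t + 20) * Real.exp t - (4 * t + 7))
      (fun t => by
        convert hasDerivAt_expPoly 0 0 6 (-13) 0 4 20 0 (-4) (-7) t using 1
        · ext x; ring
        · ring)
      (by norm_num) h3 ht
  have h1 : ∀ t : ℝ, 0 < t →
      0 < (3 * t - 8) * Real.exp t ^ 2 + (4 * t + 16) * Real.exp t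
        - (2 * t ^ 2 + 7 * t + 8) := fun t ht =>
    pos_of_hasDerivAt_pos
      (f := fun t => (3 * t - 8) * Real.exp t ^ 2 + (4 * t + 16) * Real.exp t
        - (2 * t ^ 2 + 7 * t + 8))
      (fun t => by
        convert hasDerivAt_expPoly 0 0 3 (-8) 0 4 16 (-2) (-7) (-8) t using 1
        · ext x; ring
        · ring)
      (by norm_num) h2 ht
  exact pos_of_hasDerivAt_pos
    (f := fun t => (t - 3) * Real.exp t ^ 3 + (2 * t + 7) * Real.exp t ^ 2
      + (-2 * t ^ 2 - 3 * t - 5) * Real.exp t + 1)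
    (f' := fun t => Real.exp t * ((3 * t - 8) * Real.exp t ^ 2 + (4 * t + 16) * Real.exp t
        - (2 * t ^ 2 + 7 * t + 8)))
    (fun t => by
      convert hasDerivAt_expPoly 1 (-3) 2 7 (-2) (-3) (-5) 0 0 1 t using 1
      · ext x; ring
      · ring)
    (by norm_num) (fun t ht => mul_pos (Real.exp_pos t) (h1 t ht)) ht

lemma exp_sub_one_pos {t : ℝ} (ht : 0 < t) : 0 < Real.exp t - 1 := by
  linarith [Real.add_one_lt_exp ht.ne']

lemma exp_sub_one_sub_pos {t : ℝ} (ht : t ≠ 0) : 0 < Real.exp t - 1 - t := by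
  linarith [Real.add_one_lt_exp ht]

/-- The logarithm of `h` on the positive half-line. -/
noncomputable def logH (t : ℝ) : ℝ :=
  t + Real.log (Real.exp t - 1 - t) - 2 * Real.log (Real.exp t - 1)

/-- The derivative of `logH` on the positive half-line. -/
noncomputable def logHDeriv (t : ℝ) : ℝ :=
  1 + (Real.exp t - 1) / (Real.exp t - 1 - t) - 2 * (Real.exp t / (Real.exp t - 1))

lemma h_eq_exp_logH {t : ℝ} (ht : 0 < t) : h t = Real.exp (logH t) := by
  have h1 := exp_sub_one_pos ht
  rw [h, if_neg ht.ne', logH, Real.exp_sub, Real.exp_add, Real.exp_log (exp_sub_one_sub_pos ht.ne'),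
    two_mul, Real.exp_add, Real.exp_log h1, sq]

lemma hasDerivAt_logH {t : ℝ} (ht : 0 < t) : HasDerivAt logH (logHDeriv t) t := by
  have hE := (Real.hasDerivAt_exp t).sub_const 1
  have hid := hasDerivAt_id' t
  exact (hid.add ((hE.sub hid).log (exp_sub_one_sub_pos ht.ne').ne')).sub
    ((hE.log (exp_sub_one_pos ht).ne').const_mul 2)

lemma hasDerivAt_logHDeriv {t : ℝ} (ht : 0 < t) :
    HasDerivAt logHDeriv
      (-((t - 3) * Real.exp t ^ 3 + (2 * t + 7) * Real.exp t ^ 2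
        + (-2 * t ^ 2 - 3 * t - 5) * Real.exp t + 1)
        / ((Real.exp t - 1 - t) ^ 2 * (Real.exp t - 1) ^ 2)) t := by
  have hE := Real.hasDerivAt_exp t
  have hE1 := hE.sub_const 1
  have hid := hasDerivAt_id' t
  have h1 := (exp_sub_one_pos ht).ne'
  have h2 := (exp_sub_one_sub_pos ht.ne').ne'
  refine (((hE1.div (hE1.sub hid) h2).const_add 1).sub
    ((hE.div hE1 h1).const_mul 2)).congr_deriv ?_
  simp only [Pi.sub_apply]
  field_simp
  ring

lemma strictAntiOn_logHDeriv : StrictAntiOn logHDeriv (Set.Ioi 0) := by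
  apply strictAntiOn_of_deriv_neg (convex_Ioi 0)
  · exact fun x hx => (hasDerivAt_logHDeriv hx).continuousAt.continuousWithinAt
  · intro x hx
    rw [interior_Ioi] at hx
    rw [(hasDerivAt_logHDeriv hx).deriv]
    have h1 := exp_sub_one_pos hx
    have h2 := exp_sub_one_sub_pos (ne_of_gt hx)
    exact div_neg_of_neg_of_pos (neg_neg_of_pos (expPoly_pos hx)) (by positivity)

lemma strictMonoOn_logH_split {s : ℝ} (hs : s ∈ Set.Ioo (0 : ℝ) 1) :
    StrictMonoOn (fun t => logH (s * t) + logH ((1 - s) * t) - logH t) (Set.Ioi 0) := by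
  obtain ⟨hs0, hs1⟩ := hs
  have hs' : 0 < 1 - s := by linarith
  have hd : ∀ t : ℝ, 0 < t →
      HasDerivAt (fun t => logH (s * t) + logH ((1 - s) * t) - logH t)
        (logHDeriv (s * t) * s + logHDeriv ((1 - s) * t) * (1 - s) - logHDeriv t) t := by
    intro t ht
    have hlin : ∀ r : ℝ, HasDerivAt (fun t => r * t) r t := fun r => by
      simpa using (hasDerivAt_id' t).const_mul r
    exact (((hasDerivAt_logH (mul_pos hs0 ht)).comp t (hlin s)).add
      ((hasDerivAt_logH (mul_pos hs' ht)).comp t (hlin (1 - s)))).sub (hasDerivAt_logH ht)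
  apply strictMonoOn_of_deriv_pos (convex_Ioi 0)
  · exact fun x hx => (hd x hx).continuousAt.continuousWithinAt
  · intro t ht
    rw [interior_Ioi] at ht
    rw [(hd t ht).deriv]
    have ht' : 0 < t := ht
    have h1 : logHDeriv t < logHDeriv (s * t) :=
      strictAntiOn_logHDeriv (mul_pos hs0 ht') ht (by nlinarith)
    have h2 : logHDeriv t < logHDeriv ((1 - s) * t) :=
      strictAntiOn_logHDeriv (mul_pos hs' ht') ht (by nlinarith)
    nlinarith [mul_lt_mul_of_pos_right h1 hs0, mul_lt_mul_of_pos_right h2 hs']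

lemma h_mul_split_lt {s a b : ℝ} (hs : s ∈ Set.Ioo (0 : ℝ) 1) (ha : 0 < a) (hab : a < b) :
    h b * (h (s * a) * h ((1 - s) * a)) < h a * (h (s * b) * h ((1 - s) * b)) := by
  have hs' : 0 < 1 - s := by linarith [hs.2]
  have hb := ha.trans hab
  have key := strictMonoOn_logH_split hs ha hb hab
  simp only [h_eq_exp_logH, ha, hb, mul_pos hs.1, mul_pos hs', ← Real.exp_add, Real.exp_lt_exp]
  dsimp only at key
  linarith

lemma h_pos (t : ℝ) : 0 < h t := by
  unfold h
  split_ifs with ht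
  · norm_num
  · have h1 := exp_sub_one_sub_pos ht
    have h2 : Real.exp t - 1 ≠ 0 := by simpa [sub_eq_zero] using ht
    positivity

lemma h_le_one {t : ℝ} (ht : 0 ≤ t) : h t ≤ 1 := by
  unfold h
  split_ifs with h0
  · norm_num
  · have h1 := exp_sub_one_pos (ht.lt_of_ne' h0)
    rw [div_le_one (by positivity)]
    have h2 := Real.add_one_le_exp (-t)
    have h3 : Real.exp t * Real.exp (-t) = 1 := by rw [← Real.exp_add]; simp
    nlinarith [mul_le_mul_of_nonneg_left h2 (Real.exp_pos t).le]

lemma measurable_h : Measurable h :=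
  Measurable.ite (measurableSet_singleton 0) measurable_const (by fun_prop)

lemma intervalIntegrable_split (m n : ℕ) {t : ℝ} (ht : 0 < t) :
    IntervalIntegrable (fun s => s ^ m * (1 - s) ^ n * (h (s * t) * h ((1 - s) * t)))
      volume 0 1 := by
  have hm := measurable_h
  rw [intervalIntegrable_iff_integrableOn_Ioc_of_le zero_le_one]
  refine Measure.integrableOn_of_bounded (M := 1) (by simp)
    (Measurable.aestronglyMeasurable (by fun_prop)) ?_
  refine (ae_restrict_iff' measurableSet_Ioc).2 (Filter.Eventually.of_forall fun s hs => ?_)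
  have hs0 := hs.1.le
  have hs1 : 0 ≤ 1 - s := by linarith [hs.2]
  have p1 := h_pos (s * t)
  have p2 := h_pos ((1 - s) * t)
  rw [Real.norm_of_nonneg (by positivity)]
  exact mul_le_one₀ (mul_le_one₀ (pow_le_one₀ hs0 hs.2) (by positivity)
      (pow_le_one₀ hs1 (by linarith))) (by positivity)
    (mul_le_one₀ (h_le_one (by positivity)) p2.le (h_le_one (by positivity)))

lemma integral_eq_pow_mul (m n : ℕ) (t : ℝ) :
    ∫ u in (0:ℝ)..t, u ^ m * (t - u) ^ n * h u * h (t - u)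
      = t ^ (m + n + 1) * ∫ s in (0:ℝ)..1, s ^ m * (1 - s) ^ n * (h (s * t) * h ((1 - s) * t)) := by
  have key := intervalIntegral.mul_integral_comp_mul_right (a := 0) (b := 1)
    (f := fun u => u ^ m * (t - u) ^ n * h u * h (t - u)) t
  rw [zero_mul, one_mul] at key
  rw [← key, pow_succ', mul_assoc, ← intervalIntegral.integral_const_mul (t ^ (m + n))]
  congr 1
  refine intervalIntegral.integral_congr fun s _ => ?_
  rw [show t - s * t = (1 - s) * t by ring, mul_pow, mul_pow, pow_add]
  ring

theorem frakY_strictAnti (m n : ℕ) : StrictAntiOn (frakY m n) (Set.Ioi 0) := by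
  intro a ha b hb hab
  have eq : ∀ t : ℝ, 0 < t → frakY m n t
      = h t / ∫ s in (0:ℝ)..1, s ^ m * (1 - s) ^ n * (h (s * t) * h ((1 - s) * t)) := by
    intro t ht
    rw [frakY, integral_eq_pow_mul, mul_div_mul_left _ _ (by positivity)]
  have weight_pos : ∀ s ∈ Set.Ioo (0 : ℝ) 1, 0 < s ^ m * (1 - s) ^ n := fun s hs =>
    mul_pos (pow_pos hs.1 m) (pow_pos (by linarith [hs.2]) n)
  have pos : ∀ t : ℝ, 0 < t →
      0 < ∫ s in (0:ℝ)..1, s ^ m * (1 - s) ^ n * (h (s * t) * h ((1 - s) * t)) := fun t ht =>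
    intervalIntegral.intervalIntegral_pos_of_pos_on (intervalIntegrable_split m n ht)
      (fun s hs => mul_pos (weight_pos s hs) (mul_pos (h_pos _) (h_pos _))) one_pos
  rw [eq a ha, eq b hb, div_lt_div_iff₀ (pos b hb) (pos a ha), ← sub_pos,
    ← intervalIntegral.integral_const_mul, ← intervalIntegral.integral_const_mul,
    ← intervalIntegral.integral_sub ((intervalIntegrable_split m n hb).const_mul _)
      ((intervalIntegrable_split m n ha).const_mul _)]
  refine intervalIntegral.intervalIntegral_pos_of_pos_on
    (((intervalIntegrable_split m n hb).const_mul _).sub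
      ((intervalIntegrable_split m n ha).const_mul _)) (fun s hs => ?_) one_pos
  have := mul_lt_mul_of_pos_left (h_mul_split_lt hs ha hab) (weight_pos s hs)
  linarith
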